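/- arXiv:1804.02087 — 2 statements merged into one kernel-verified Lean document; each statement's English description precedes it below -/
import Mathlib

section
/- Let c₁ > 0 and ε > 0 be real constants. For each positive integer m large enough that 1 − 2c₁/m > 0, set σ_m = 1 − 2c₁/m and l_m = ⌈m(1+ε)⌉. Let D_m be a random m × l_m matrix over 𝔽₂ whose columns are independent σ_m-sparse vectors, and for a fixed i let Y_i^{(m)} be the number of vectors x ∈ 𝔽₂^{l_m} with Hamming weight at least l_m/2 such that D_m x = e_i. Then lim_{m→∞} 1/𝔼[Y_i^{(m)}] = 0, i.e. 𝔼[Y_i^{(m)}] → ∞ as m → ∞. -/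
open MeasureTheory

/-- The law of a single `σ`-sparse bit in `𝔽₂`: it equals `0` with probability `(1+σ)/2`
and `1` with probability `(1-σ)/2`. -/
noncomputable def bitMeasure (σ : ℝ) : Measure (ZMod 2) :=
  ENNReal.ofReal ((1 + σ) / 2) • Measure.dirac 0 +
    ENNReal.ofReal ((1 - σ) / 2) • Measure.dirac 1

/-- The law of a random `m × l` matrix over `𝔽₂` (encoded as a function on index pairs)
whose columns are independent `σ`-sparse vectors, i.e. all of whose `m·l` entries are
i.i.d. `σ`-sparse bits. -/
noncomputable def matMeasure (σ : ℝ) (m l : ℕ) : Measure ((Fin m × Fin l) → ZMod 2) :=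
  Measure.pi fun _ => bitMeasure σ

/-- `Ycount m l i D` is the number of vectors `x ∈ 𝔽₂^l` of Hamming weight at least `l/2`
such that `D x = e i`, for the matrix `D` encoded as a function on index pairs. -/
noncomputable def Ycount (m l : ℕ) (i : Fin m) (D : (Fin m × Fin l) → ZMod 2) : ℕ :=
  (Finset.univ.filter fun x : Fin l → ZMod 2 =>
    l ≤ 2 * (Finset.univ.filter fun j => x j ≠ 0).card ∧
      (Matrix.of fun a b => D (a, b)).mulVec x = Pi.single i 1).card

/-- `EY σ m l i` is the expected number `𝔼[Y i]` of vectors `x ∈ 𝔽₂^l` of Hamming weight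
at least `l/2` with `D x = e i`, where `D` is a random `m × l` matrix over `𝔽₂` with
independent `σ`-sparse columns. -/
noncomputable def EY (σ : ℝ) (m l : ℕ) (i : Fin m) : ℝ :=
  ∫ D, (Ycount m l i D : ℝ) ∂(matMeasure σ m l)

/-- The probability mass function of a `σ`-sparse bit. -/
noncomputable def bitMass (σ : ℝ) (v : ZMod 2) : ℝ := if v = 0 then (1 + σ) / 2 else (1 - σ) / 2

/-- The nontrivial real character of `𝔽₂`. -/
noncomputable def signChar (v : ZMod 2) : ℝ := if v = 0 then 1 else -1

lemma zmod_two_eq_zero_or_one : ∀ v : ZMod 2, v = 0 ∨ v = 1 := by decide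

lemma signChar_add (u v : ZMod 2) : signChar (u + v) = signChar u * signChar v := by
  obtain rfl | rfl := zmod_two_eq_zero_or_one u <;> obtain rfl | rfl := zmod_two_eq_zero_or_one v <;>
    simp [signChar, CharTwo.add_self_eq_zero]

lemma signChar_sum {ι : Type*} (s : Finset ι) (f : ι → ZMod 2) :
    signChar (∑ j ∈ s, f j) = ∏ j ∈ s, signChar (f j) := by
  classical
  induction s using Finset.induction_on with
  | empty => simp [signChar]
  | insert a s ha ih => rw [Finset.sum_insert ha, Finset.prod_insert ha, signChar_add, ih]

lemma ite_eq_signChar (u v : ZMod 2) :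
    (if u = v then (1 : ℝ) else 0) = (1 + signChar v * signChar u) / 2 := by
  obtain rfl | rfl := zmod_two_eq_zero_or_one u <;> obtain rfl | rfl := zmod_two_eq_zero_or_one v <;>
    simp [signChar]

lemma sum_zmod_two (f : ZMod 2 → ℝ) : ∑ v, f v = f 0 + f 1 := Fin.sum_univ_two f

lemma sum_bitMass (σ : ℝ) : ∑ v, bitMass σ v = 1 := by
  rw [sum_zmod_two]; simp [bitMass]; ring

lemma sum_bitMass_mul_signChar (σ : ℝ) (y : ZMod 2) :
    ∑ v, bitMass σ v * signChar (v * y) = if y ≠ 0 then σ else 1 := by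
  rw [sum_zmod_two]
  obtain rfl | rfl := zmod_two_eq_zero_or_one y <;> simp [bitMass, signChar] <;> ring

/-- The probability that a random row with i.i.d. `σ`-sparse entries pairs with `x` to `t`. -/
lemma sum_row_mass (σ : ℝ) {l : ℕ} (x : Fin l → ZMod 2) (t : ZMod 2) :
    ∑ r : Fin l → ZMod 2, (∏ b, bitMass σ (r b)) * (if ∑ b, r b * x b = t then 1 else 0) =
      (1 + signChar t * σ ^ (Finset.univ.filter fun j => x j ≠ 0).card) / 2 := by
  have hmass : ∑ r : Fin l → ZMod 2, ∏ b, bitMass σ (r b) = 1 := by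
    rw [← Fintype.prod_sum]
    simp [sum_bitMass]
  have hsign : ∑ r : Fin l → ZMod 2, ∏ b, bitMass σ (r b) * signChar (r b * x b) =
      σ ^ (Finset.univ.filter fun j => x j ≠ 0).card := by
    rw [← Fintype.prod_sum (fun b v => bitMass σ v * signChar (v * x b))]
    simp only [sum_bitMass_mul_signChar]
    rw [Finset.prod_ite]
    simp
  simp only [ite_eq_signChar, signChar_sum]
  rw [← hsign]
  nth_rewrite 2 [← hmass]
  rw [Finset.mul_sum, ← Finset.sum_add_distrib, Finset.sum_div]
  refine Finset.sum_congr rfl fun r _ => ?_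
  rw [Finset.prod_mul_distrib]
  ring

instance isFiniteMeasure_bitMeasure (σ : ℝ) : IsFiniteMeasure (bitMeasure σ) := by
  constructor
  simp [bitMeasure]

lemma bitMeasure_real_singleton {σ : ℝ} (h0 : -1 ≤ σ) (h1 : σ ≤ 1) (v : ZMod 2) :
    (bitMeasure σ).real {v} = bitMass σ v := by
  have h2 : 0 ≤ (1 + σ) / 2 := by linarith
  have h3 : 0 ≤ (1 - σ) / 2 := by linarith
  obtain rfl | rfl := zmod_two_eq_zero_or_one v <;>
    simp [bitMeasure, bitMass, measureReal_def, h2, h3]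

lemma matMeasure_real_singleton {σ : ℝ} (h0 : -1 ≤ σ) (h1 : σ ≤ 1) {m l : ℕ}
    (D : Fin m × Fin l → ZMod 2) :
    (matMeasure σ m l).real {D} = ∏ a, ∏ b, bitMass σ (D (a, b)) := by
  rw [matMeasure, measureReal_def, Measure.pi_singleton, ENNReal.toReal_prod,
    ← Fintype.prod_prod_type']
  exact Finset.prod_congr rfl fun p _ => bitMeasure_real_singleton h0 h1 _

instance isFiniteMeasure_matMeasure (σ : ℝ) (m l : ℕ) : IsFiniteMeasure (matMeasure σ m l) := by
  unfold matMeasure; infer_instance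

/-- The probability that `D x = y` for a random matrix `D` with i.i.d. `σ`-sparse entries. -/
lemma sum_matrix_mass (σ : ℝ) {m l : ℕ} (x : Fin l → ZMod 2) (y : Fin m → ZMod 2) :
    ∑ D : Fin m × Fin l → ZMod 2, (∏ a, ∏ b, bitMass σ (D (a, b))) *
        (if (Matrix.of fun a b => D (a, b)).mulVec x = y then 1 else 0) =
      ∏ a, (1 + signChar (y a) * σ ^ (Finset.univ.filter fun j => x j ≠ 0).card) / 2 := by
  simp only [← sum_row_mass]
  rw [Fintype.prod_sum (fun a (r : Fin l → ZMod 2) =>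
    (∏ b, bitMass σ (r b)) * (if ∑ b, r b * x b = y a then (1 : ℝ) else 0))]
  refine Fintype.sum_equiv (Equiv.curry _ _ _) _ _ fun D => ?_
  rw [Finset.prod_mul_distrib, Finset.prod_ite_zero]
  simp [funext_iff, Matrix.mulVec, dotProduct]

lemma EY_eq_sum {σ : ℝ} (h0 : -1 ≤ σ) (h1 : σ ≤ 1) (m l : ℕ) (i : Fin m) :
    EY σ m l i = ∑ x : Fin l → ZMod 2 with
        l ≤ 2 * (Finset.univ.filter fun j => x j ≠ 0).card,
      ∏ a, (1 + signChar ((Pi.single i 1 : Fin m → ZMod 2) a) *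
        σ ^ (Finset.univ.filter fun j => x j ≠ 0).card) / 2 := by
  rw [EY, integral_fintype (Integrable.of_finite)]
  simp only [matMeasure_real_singleton h0 h1, ← sum_matrix_mass, Ycount, smul_eq_mul]
  rw [Finset.sum_comm]
  refine Finset.sum_congr rfl fun D _ => ?_
  rw [← Finset.mul_sum, ← Finset.filter_filter, Finset.card_filter]
  push_cast
  rfl

lemma two_pow_le_two_mul_card_heavy (l : ℕ) :
    2 ^ l ≤ 2 * (Finset.univ.filter fun x : Fin l → ZMod 2 =>
      l ≤ 2 * (Finset.univ.filter fun j => x j ≠ 0).card).card := by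
  have hsplit := Finset.card_filter_add_card_filter_not (s := Finset.univ)
    (fun x : Fin l → ZMod 2 => l ≤ 2 * (Finset.univ.filter fun j => x j ≠ 0).card)
  have hle : (Finset.univ.filter fun x : Fin l → ZMod 2 =>
      ¬ l ≤ 2 * (Finset.univ.filter fun j => x j ≠ 0).card).card ≤
      (Finset.univ.filter fun x : Fin l → ZMod 2 =>
      l ≤ 2 * (Finset.univ.filter fun j => x j ≠ 0).card).card := by
    refine Finset.card_le_card_of_injOn (fun x => x + 1) (fun x hx => ?_)
      (add_left_injective _).injOn
    have hflip : ∀ v : ZMod 2, v + 1 ≠ 0 ↔ ¬ v ≠ 0 := by decide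
    have hx' := Finset.card_filter_add_card_filter_not (s := Finset.univ) (fun j => x j ≠ 0)
    simp only [Finset.coe_filter, Finset.mem_univ, true_and, Set.mem_ofPred_eq, Pi.add_apply,
      Pi.one_apply, hflip, Finset.card_univ, Fintype.card_fin] at hx hx' ⊢
    omega
  simp only [Finset.card_univ, Fintype.card_fun, ZMod.card, Fintype.card_fin] at hsplit
  omega

lemma prod_signChar_single_ge {s δ : ℝ} (hs : 0 ≤ s) (hδ : δ ≤ 1 - s) (hδ0 : 0 ≤ δ)
    {m : ℕ} (i : Fin m) :
    δ * (1 / 2) ^ m ≤ ∏ a, (1 + signChar ((Pi.single i 1 : Fin m → ZMod 2) a) * s) / 2 := by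
  have hconst : δ * (1 / 2) ^ m = ∏ a, (if a = i then δ / 2 else 1 / 2 : ℝ) := by
    have : ∀ a, (if a = i then δ / 2 else 1 / 2 : ℝ) = (if a = i then δ else 1) * (1 / 2) := by
      intro a; split_ifs <;> ring
    simp only [this, Finset.prod_mul_distrib]
    simp
  rw [hconst]
  refine Finset.prod_le_prod (fun a _ => ?_) fun a _ => ?_
  · split_ifs <;> linarith
  · split_ifs with h
    · subst h
      simp [signChar]
      linarith
    · simp [signChar, h]
      linarith

lemma EY_ge {σ δ : ℝ} (h0 : 0 ≤ σ) (h1 : σ ≤ 1) {m l : ℕ} (hδ0 : 0 ≤ δ)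
    (hδ : ∀ k : ℕ, l ≤ 2 * k → σ ^ k ≤ 1 - δ) (i : Fin m) :
    2 ^ l / 2 * (δ * (1 / 2) ^ m) ≤ EY σ m l i := by
  rw [EY_eq_sum (by linarith) h1]
  have hcard : (2 : ℝ) ^ l / 2 ≤ (Finset.univ.filter fun x : Fin l → ZMod 2 =>
      l ≤ 2 * (Finset.univ.filter fun j => x j ≠ 0).card).card := by
    rw [div_le_iff₀' two_pos]
    exact_mod_cast two_pow_le_two_mul_card_heavy l
  refine (mul_le_mul_of_nonneg_right hcard (by positivity)).trans ?_
  rw [← nsmul_eq_mul]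
  refine Finset.card_nsmul_le_sum _ _ _ fun x hx => ?_
  have := hδ _ (Finset.mem_filter.1 hx).2
  exact prod_signChar_single_ge (pow_nonneg h0 _) (by linarith) hδ0 i

lemma one_sub_pow_le_exp {c M : ℝ} (hM : 0 < M) (hc : 0 < c) (h : 2 * c ≤ M) {k : ℕ}
    (hk : M ≤ 2 * k) : (1 - 2 * c / M) ^ k ≤ Real.exp (-c) := by
  have hbase : 0 ≤ 1 - 2 * c / M := by
    rw [sub_nonneg, div_le_one hM]; exact h
  calc (1 - 2 * c / M) ^ k ≤ Real.exp (-(2 * c / M)) ^ k :=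
        pow_le_pow_left₀ hbase (Real.one_sub_le_exp_neg _) k
    _ = Real.exp (k * -(2 * c / M)) := (Real.exp_nat_mul _ _).symm
    _ ≤ Real.exp (-c) := by
        rw [Real.exp_le_exp]
        have : c * M / M ≤ c * (2 * k) / M := by gcongr
        rw [mul_div_cancel_right₀ _ hM.ne'] at this
        have h2 : (k : ℝ) * -(2 * c / M) = -(c * (2 * k) / M) := by ring
        linarith

/-- Let `c₁ > 0` and `ε > 0`.  For each `m`, set `σ_m = 1 - 2c₁/m` and
`l_m = ⌈m(1+ε)⌉`; let `D_m` be a random `m × l_m` matrix over `𝔽₂` with independent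
`σ_m`-sparse columns, and for an index `i` of `{1,…,m}` let `Y_i^{(m)}` be the number of
vectors `x ∈ 𝔽₂^{l_m}` of Hamming weight at least `l_m/2` with `D_m x = e i`.  Then
`1/𝔼[Y_i^{(m)}] → 0`, i.e. `𝔼[Y_i^{(m)}] → ∞`, as `m → ∞`.
(The sequence is indexed by `m+1` so that the index `i` always exists.) -/
theorem stmt9 (c₁ ε : ℝ) (hc : 0 < c₁) (hε : 0 < ε) (i : ∀ m : ℕ, Fin (m + 1)) :
    Filter.Tendsto (fun m : ℕ =>
        1 / EY (1 - 2 * c₁ / ((m : ℝ) + 1)) (m + 1) ⌈((m : ℝ) + 1) * (1 + ε)⌉₊ (i m))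
      Filter.atTop (nhds 0) ∧
    Filter.Tendsto (fun m : ℕ =>
        EY (1 - 2 * c₁ / ((m : ℝ) + 1)) (m + 1) ⌈((m : ℝ) + 1) * (1 + ε)⌉₊ (i m))
      Filter.atTop Filter.atTop := by
  suffices h : Filter.Tendsto (fun m : ℕ =>
      EY (1 - 2 * c₁ / ((m : ℝ) + 1)) (m + 1) ⌈((m : ℝ) + 1) * (1 + ε)⌉₊ (i m))
      Filter.atTop Filter.atTop by
    refine ⟨?_, h⟩
    simp only [one_div]
    exact h.inv_tendsto_atTop
  have hδ : 0 < 1 - Real.exp (-c₁) := by simpa using hc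
  have hcast : Filter.Tendsto (fun m : ℕ => (m : ℝ) + 1) Filter.atTop Filter.atTop :=
    Filter.tendsto_atTop_add_const_right _ _ tendsto_natCast_atTop_atTop
  have hpow : Filter.Tendsto (fun m : ℕ =>
      (1 - Real.exp (-c₁)) / 2 * (2 : ℝ) ^ (((m : ℝ) + 1) * ε))
      Filter.atTop Filter.atTop :=
    ((tendsto_rpow_atTop_of_base_gt_one 2 one_lt_two).comp
      (hcast.atTop_mul_const hε)).const_mul_atTop (by positivity)
  refine Filter.tendsto_atTop_mono' _ ?_ hpow
  filter_upwards [hcast.eventually_ge_atTop (2 * c₁)] with m hm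
  have hM : (0 : ℝ) < m + 1 := by positivity
  have hl : ((m : ℝ) + 1) * (1 + ε) ≤ ⌈((m : ℝ) + 1) * (1 + ε)⌉₊ := Nat.le_ceil _
  set l := ⌈((m : ℝ) + 1) * (1 + ε)⌉₊
  have hσ0 : 0 ≤ 1 - 2 * c₁ / ((m : ℝ) + 1) := by
    rw [sub_nonneg, div_le_one hM]; exact hm
  have hσ1 : 1 - 2 * c₁ / ((m : ℝ) + 1) ≤ 1 := by
    have : 0 ≤ 2 * c₁ / ((m : ℝ) + 1) := by positivity
    linarith
  refine le_trans ?_ (EY_ge hσ0 hσ1 hδ.le (fun k hk => ?_) (i m))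
  · have hexp : (2 : ℝ) ^ (((m : ℝ) + 1) * ε) ≤ 2 ^ l * (1 / 2) ^ (m + 1) := by
      have : (2 : ℝ) ^ l * (1 / 2) ^ (m + 1) = (2 : ℝ) ^ ((l : ℝ) - ((m + 1 : ℕ) : ℝ)) := by
        rw [Real.rpow_sub two_pos, Real.rpow_natCast, Real.rpow_natCast, one_div, inv_pow]
        rfl
      rw [this]
      refine Real.rpow_le_rpow_of_exponent_le one_le_two ?_
      push_cast
      linarith
    calc _ ≤ (1 - Real.exp (-c₁)) / 2 * (2 ^ l * (1 / 2) ^ (m + 1)) := by gcongr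
      _ = _ := by ring
  · rw [sub_sub_cancel]
    refine one_sub_pow_le_exp hM hc hm ?_
    have : (l : ℝ) ≤ 2 * k := by exact_mod_cast hk
    have : 0 ≤ ((m : ℝ) + 1) * ε := by positivity
    linarith
end

section
/- Let M, K, C be finite nonempty types with |M| = |K| = |C|, and let e : M × K → C be an encoding function such that for every key k the map m ↦ e(m,k) is injective (so that decryption is possible). Let the key be a random element of K, independent of the message. Then the scheme achieves perfect secrecy — meaning that for every probability distribution on M with full support, the random ciphertext e(M, K) is independent of the message M — if and only if both of the following hold: (1) for each pair (m, c) ∈ M × C there exists a unique key k ∈ K with e(m, k) = c, and (2) the key K is uniformly distributed on K. -/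
/-- The joint distribution of the pair (message, ciphertext) in the Shannon cipher system:
the message `m` is drawn from `μM`, the key `k` is drawn from `μK` independently of the
message, and the ciphertext is `e (m, k)`. -/
noncomputable def jointPMF {M K C : Type*} (e : M × K → C) (μM : PMF M) (μK : PMF K) :
    PMF (M × C) :=
  μM.bind fun m => μK.map fun k => (m, e (m, k))

theorem PMF.map_apply_of_injective {α β : Type*} {f : α → β} (hf : Function.Injective f)
    (p : PMF α) (a : α) : p.map f (f a) = p a := by
  classical
  rw [PMF.map_apply, tsum_eq_single a fun b hb => if_neg fun h => hb (hf h).symm, if_pos rfl]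

theorem PMF.eq_uniformOfFintype_of_forall_eq {α : Type*} [Fintype α] [Nonempty α] {p : PMF α}
    {q : ENNReal} (h : ∀ a, p a = q) : p = PMF.uniformOfFintype α := by
  have hsum := p.tsum_coe
  rw [tsum_fintype, Finset.sum_congr rfl fun a _ => h a, Finset.sum_const, Finset.card_univ,
    nsmul_eq_mul, mul_comm] at hsum
  ext a
  rw [h, PMF.uniformOfFintype_apply, ENNReal.eq_inv_of_mul_eq_one_left hsum]

section JointPMF

variable {M K C : Type*} (e : M × K → C) (μM : PMF M) (μK : PMF K)

theorem jointPMF_apply (m : M) (c : C) :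
    jointPMF e μM μK (m, c) = μM m * μK.map (fun k => e (m, k)) c := by
  classical
  rw [jointPMF, PMF.bind_apply, tsum_eq_single m]
  · simp [PMF.map_apply]
  · intro m' hm'
    simp [PMF.map_apply, hm'.symm]

theorem jointPMF_map_fst : (jointPMF e μM μK).map Prod.fst = μM := by
  have hconst (m : M) : μK.map (fun _ => m) = PMF.pure m := μK.map_const m
  simp [jointPMF, PMF.map_bind, PMF.map_comp, Function.comp_def, hconst]

theorem jointPMF_map_snd :
    (jointPMF e μM μK).map Prod.snd = μM.bind fun m => μK.map fun k => e (m, k) := by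
  simp [jointPMF, PMF.map_bind, PMF.map_comp, Function.comp_def]

end JointPMF

/-- Shannon's characterization of perfect secrecy, the paper's
Theorem 2.  Let `M, K, C` be finite nonempty types with `|M| = |K| = |C|`, and let
`e : M × K → C` be an encoding function such that for every key `k` the map
`m ↦ e (m, k)` is injective (so decryption is possible).  Let the key be a random element
of `K` with distribution `μK`, independent of the message.  Then the scheme achieves
perfect secrecy — for every message distribution `μM` with full support, the random
ciphertext `e (M, K)` is independent of the message `M` (the joint law of the pair
(message, ciphertext) is the product of its marginals) — if and only if
(1) for each pair `(m, c)` there is a unique key `k` with `e (m, k) = c`, and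
(2) the key is uniformly distributed on `K`. -/
theorem stmt12 {M K C : Type*} [Fintype M] [Fintype K] [Fintype C]
    [Nonempty M] [Nonempty K] [Nonempty C]
    (hMK : Fintype.card M = Fintype.card K) (hKC : Fintype.card K = Fintype.card C)
    (e : M × K → C) (hinj : ∀ k : K, Function.Injective fun m => e (m, k)) (μK : PMF K) :
    (∀ μM : PMF M, (∀ m, μM m ≠ 0) →
      ∀ (m : M) (c : C),
        jointPMF e μM μK (m, c) =
          (jointPMF e μM μK).map Prod.fst m * (jointPMF e μM μK).map Prod.snd c) ↔
    ((∀ (m : M) (c : C), ∃! k : K, e (m, k) = c) ∧ μK = PMF.uniformOfFintype K) := by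
  simp only [jointPMF_apply, jointPMF_map_fst, jointPMF_map_snd]
  constructor
  · intro h
    have hfull (m : M) : PMF.uniformOfFintype M m ≠ 0 := by simp
    set Q : PMF C := (PMF.uniformOfFintype M).bind fun m => μK.map fun k => e (m, k)
    have hcond (m : M) (c : C) : μK.map (fun k => e (m, k)) c = Q c :=
      (ENNReal.mul_right_inj (hfull m) (PMF.apply_ne_top _ m)).1 (h _ hfull m c)
    have hsurjM (k : K) : Function.Surjective fun m => e (m, k) :=
      ((Fintype.bijective_iff_injective_and_card _).2 ⟨hinj k, hMK.trans hKC⟩).2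
    obtain ⟨k₀, hk₀⟩ := μK.support_nonempty
    have hbij (m : M) : Function.Bijective fun k => e (m, k) := by
      refine (Fintype.bijective_iff_surjective_and_card _).2 ⟨fun c => ?_, hKC⟩
      obtain ⟨m', hm'⟩ := hsurjM k₀ c
      have hc : c ∈ (μK.map fun k => e (m', k)).support :=
        (PMF.mem_support_map_iff _ _ _).2 ⟨k₀, hk₀, hm'⟩
      rw [PMF.mem_support_iff, hcond, ← hcond m, ← PMF.mem_support_iff,
        PMF.mem_support_map_iff] at hc
      obtain ⟨k, -, hk⟩ := hc
      exact ⟨k, hk⟩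
    refine ⟨fun m => (hbij m).existsUnique, ?_⟩
    obtain ⟨c⟩ := ‹Nonempty C›
    refine PMF.eq_uniformOfFintype_of_forall_eq (q := Q c) fun k => ?_
    obtain ⟨m, rfl⟩ := hsurjM k c
    rw [← hcond m, PMF.map_apply_of_injective (hbij m).1]
  · rintro ⟨hex, rfl⟩ μM - m c
    have hunif (m : M) :
        (PMF.uniformOfFintype K).map (fun k => e (m, k)) = PMF.uniformOfFintype C := by
      have hbij := (Function.bijective_iff_existsUnique fun k => e (m, k)).2 (hex m)
      refine PMF.eq_uniformOfFintype_of_forall_eq (q := (Fintype.card K : ENNReal)⁻¹) fun c => ?_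
      obtain ⟨k, rfl⟩ := hbij.2 c
      rw [PMF.map_apply_of_injective hbij.1, PMF.uniformOfFintype_apply]
    simp only [hunif, PMF.bind_const]
end
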